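/- Let V be a nonlocal vertex algebra and let W be a vector space equipped with a linear map Y_W from V to ℰ(W) with Y_W(1, x) = 1_W. (1) If (W, Y_W) is a quasi V-module, then for any u, v ∈ V such that the ordered pair (Y_W(u,x), Y_W(v,x)) is quasi compatible, one has Y_W(Y(u,x₀)v, x) = Y_ℰ(Y_W(u,x), x₀) Y_W(v,x). (2) Conversely, if for all u, v ∈ V the pair (Y_W(u,x), Y_W(v,x)) is quasi compatible and Y_W(Y(u,x₀)v, x) = Y_ℰ(Y_W(u,x), x₀) Y_W(v,x), then (W, Y_W) is a quasi V-module. -/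

import Mathlib

noncomputable section

open Classical

namespace NVA

/-! ### The space ℰ(W) = Hom(W, W((x))), coefficient-indexed by modes:
`a w n` is the mode `a_n` applied to `w`, where `a(x)w = ∑ (a_n w) x^{-n-1}`.
Lower truncation of `a(x)w` in powers of `x` means `a_n w = 0` for `n` large. -/

variable (W : Type*) [AddCommGroup W] [Module ℂ W]

/-- `ℰ(W) = Hom(W, W((x)))` as a submodule of `Hom(W, W[[x^{±1}]])`. -/
def EWsub : Submodule ℂ (W →ₗ[ℂ] (ℤ → W)) where
  carrier := {a | ∀ w : W, ∃ N : ℤ, ∀ n : ℤ, N ≤ n → a w n = 0}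
  add_mem' := by
    intro a b ha hb w
    obtain ⟨N, hN⟩ := ha w
    obtain ⟨M, hM⟩ := hb w
    refine ⟨max N M, fun n hn => ?_⟩
    simp only [LinearMap.add_apply, Pi.add_apply,
      hN n (le_trans (le_max_left _ _) hn), hM n (le_trans (le_max_right _ _) hn), add_zero]
  zero_mem' := by intro w; exact ⟨0, fun n _ => rfl⟩
  smul_mem' := by
    intro c a ha w
    obtain ⟨N, hN⟩ := ha w
    exact ⟨N, fun n hn => by
      simp only [LinearMap.smul_apply, Pi.smul_apply, hN n hn, smul_zero]⟩

/-- The type `ℰ(W)`. -/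
abbrev EW := ↥(EWsub W)

variable {W}

/-- The mode function of an element of `ℰ(W)`. -/
def mf (a : EW W) : W → ℤ → W := fun w n => (a : W →ₗ[ℂ] (ℤ → W)) w n

/-- The identity operator `1_W`, as an element of `ℰ(W)`. -/
def oneE : EW W :=
  ⟨{ toFun := fun w n => if n = -1 then w else 0
     map_add' := by
       intro w w'; funext n; by_cases h : n = -1 <;> simp [h]
     map_smul' := by
       intro c w; funext n; by_cases h : n = -1 <;> simp [h] },
   fun w => ⟨0, fun n hn => if_neg (by omega)⟩⟩

/-- The generalized binomial coefficient `C(m, j)` for `m ∈ ℤ`, as a complex number. -/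
def binom (m : ℤ) (j : ℕ) : ℂ :=
  (∏ i ∈ Finset.range j, ((m : ℂ) - (i : ℂ))) / (j.factorial : ℂ)

/-- The coefficient of `x₁^m x₂^t` in `a(x₁) b(x₂) w`. -/
def Fab (a b : EW W) (w : W) (m t : ℤ) : W := mf a (mf b w (-t - 1)) (-m - 1)

/-- Multiplication of a two-variable family by a polynomial `p(x₁,x₂)`. -/
def mulPoly (p : MvPolynomial (Fin 2) ℂ) (F : ℤ → ℤ → W) : ℤ → ℤ → W :=
  fun m t => ∑ d ∈ p.support, MvPolynomial.coeff d p • F (m - d 0) (t - d 1)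

/-- A two-variable family lies in `W((x₁,x₂))` (jointly lower truncated). -/
def IsLaurent2 (F : ℤ → ℤ → W) : Prop :=
  ∃ N : ℤ, ∀ m t : ℤ, (m < N ∨ t < N) → F m t = 0

/-- Quasi compatibility of an ordered pair `(a(x), b(x))` in `ℰ(W)`:
`p(x₁,x₂) a(x₁) b(x₂) ∈ Hom(W, W((x₁,x₂)))` for some nonzero polynomial `p`. -/
def QCPair (a b : EW W) : Prop :=
  ∃ p : MvPolynomial (Fin 2) ℂ, p ≠ 0 ∧ ∀ w, IsLaurent2 (mulPoly p (Fab a b w))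

/-! ### Sequences -/

/-- The coefficient of `x₁^{k 1} ⋯ x_r^{k r}` in `ψ₁(x₁) ⋯ ψ_r(x_r) w`. -/
def seqCoeff : {r : ℕ} → (Fin r → EW W) → W → (Fin r → ℤ) → W
  | 0, _, w, _ => w
  | _ + 1, ψ, w, k => mf (ψ 0) (seqCoeff (Fin.tail ψ) w (Fin.tail k)) (-(k 0) - 1)

/-- The polynomial `∏_{1 ≤ i < j ≤ r} p(x_i, x_j)`. -/
def pairPoly (p : MvPolynomial (Fin 2) ℂ) (r : ℕ) : MvPolynomial (Fin r) ℂ :=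
  ∏ ij ∈ Finset.univ.filter (fun ij : Fin r × Fin r => ij.1 < ij.2),
    MvPolynomial.rename ![ij.1, ij.2] p

/-- Multiplication of an `r`-variable family by a polynomial in `r` variables. -/
def mulPolyN {r : ℕ} (P : MvPolynomial (Fin r) ℂ) (F : (Fin r → ℤ) → W) :
    (Fin r → ℤ) → W :=
  fun k => ∑ d ∈ P.support, MvPolynomial.coeff d P • F (fun i => k i - d i)

/-- An `r`-variable family lies in `W((x₁,…,x_r))`. -/
def IsLaurentN {r : ℕ} (F : (Fin r → ℤ) → W) : Prop :=
  ∃ N : ℤ, ∀ k : Fin r → ℤ, (∃ i, k i < N) → F k = 0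

/-- Quasi compatibility of an ordered sequence in `ℰ(W)`. -/
def QCSeq {r : ℕ} (ψ : Fin r → EW W) : Prop :=
  ∃ p : MvPolynomial (Fin 2) ℂ, p ≠ 0 ∧
    ∀ w, IsLaurentN (mulPolyN (pairPoly p r) (seqCoeff ψ w))

/-- Quasi compatibility of a subset of `ℰ(W)`. -/
def QCSet (S : Set (EW W)) : Prop :=
  ∀ (r : ℕ) (ψ : Fin r → EW W), (∀ i, ψ i ∈ S) → QCSeq ψ

/-! ### The vertex operation `Y_ℰ^{(α)}` -/

/-- `ℂ((x))`. -/
abbrev LC : Type := LaurentSeries ℂ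

/-- An iterated Laurent series field, e.g. `ℂ((x))((x₀))` (outer variable the second one). -/
abbrev K2 : Type := HahnSeries ℤ LC

/-- The outer variable of `K2`. -/
def xOuter : K2 := HahnSeries.single 1 1

/-- The inner variable of `K2`. -/
def xInner : K2 := HahnSeries.single 0 (HahnSeries.single 1 1)

/-- `α` times the inner variable of `K2`. -/
def xInnerC (c : ℂ) : K2 := HahnSeries.single 0 (HahnSeries.single 1 c)

/-- The polynomial `p(x₀ + α x, x)` as an element of `ℂ((x))((x₀))`
(outer variable `x₀`). -/
def qK (p : MvPolynomial (Fin 2) ℂ) (α : ℂ) : K2 :=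
  MvPolynomial.aeval ![xOuter + xInnerC α, xInner] p

/-- The expansion `ι_{x,x₀} (p(x₀ + α x, x)^{-1}) ∈ ℂ((x))((x₀))`. -/
def qInv (p : MvPolynomial (Fin 2) ℂ) (α : ℂ) : K2 := (qK p α)⁻¹

/-- The coefficient of `x₀^j x^t` in `(p(x₁,x) a(x₁) b(x) w)|_{x₁ = αx + x₀}`,
expanding via `(αx+x₀)^m = ∑_{j≥0} C(m,j) α^{m-j} x^{m-j} x₀^j`. -/
def substYE (α : ℂ) (p : MvPolynomial (Fin 2) ℂ) (a b : EW W) (w : W)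
    (j : ℕ) (t : ℤ) : W :=
  ∑ᶠ m : ℤ, (binom m j * α ^ (m - (j : ℤ))) • mulPoly p (Fab a b w) m (t - m + j)

/-- The coefficient of `x₀^J x^T` in
`ι_{x,x₀}(p(x₀+αx,x)^{-1}) ⬝ (p(x₁,x)a(x₁)b(x)w)|_{x₁ = αx+x₀}`. -/
def fullYE (α : ℂ) (p : MvPolynomial (Fin 2) ℂ) (a b : EW W) (w : W)
    (J T : ℤ) : W :=
  ∑ᶠ s : ℤ × ℤ, (((qInv p α).coeff s.1).coeff s.2) •
    (if 0 ≤ J - s.1 then substYE α p a b w (J - s.1).toNat (T - s.2) else 0)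

/-- The raw mode family of `Y_ℰ^{(α)}(a(x), x₀) b(x)`; `rawYE α a b n w m` is the mode
`m` of the element `a(x)_{(α,n)} b(x)` applied to `w`.  (Defined using a choice of
polynomial from quasi compatibility; by the general theory the value does not depend
on the choice.) -/
def rawYE (α : ℂ) (a b : EW W) (n : ℤ) (w : W) (m : ℤ) : W :=
  if h : QCPair a b then fullYE α h.choose a b w (-n - 1) (-m - 1) else 0

/-- `a(x)_{(α,n)} b(x)`, as an element of `ℰ(W)` whenever the raw family is realized
by one (which is the case for any quasi compatible pair). -/
def YEa (α : ℂˣ) (a b : EW W) (n : ℤ) : EW W :=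
  if h : ∃ c : EW W, ∀ w m, mf c w m = rawYE (α : ℂ) a b n w m then h.choose else 0

/-- `a(x)_n b(x) = a(x)_{(1,n)} b(x)`. -/
def YE (a b : EW W) (n : ℤ) : EW W := YEa 1 a b n

end NVA

namespace NVA

variable {W : Type*} [AddCommGroup W] [Module ℂ W]

/-- Submodules of `ℰ(W)` are `ℂ`-vector spaces (registered explicitly to assist
instance resolution). -/
noncomputable instance (V : Submodule ℂ (EW W)) : AddCommGroup ↥V :=
  @Submodule.addCommGroup ℂ (EW W) _ inferInstance inferInstance V

noncomputable instance (V : Submodule ℂ (EW W)) : Module ℂ ↥V :=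
  @Submodule.module ℂ (EW W) _ inferInstance inferInstance V

/-! ### Derivative and scaling operators on ℰ(W) -/

/-- `D = d/dx` on `ℰ(W)`: `(Da)_m = -m • a_{m-1}`. -/
def Dop (a : EW W) : EW W :=
  ⟨{ toFun := fun w m => (-m : ℂ) • mf a w (m - 1)
     map_add' := by intro w w'; funext m; simp [mf, map_add]
     map_smul' := by
       intro c w; funext m
       simp only [mf, map_smul, Pi.smul_apply, RingHom.id_apply]
       exact smul_comm _ _ _ },
   by
     intro w
     obtain ⟨N, hN⟩ := a.2 w
     exact ⟨N + 1, fun m hm => by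
       have : (a : W →ₗ[ℂ] (ℤ → W)) w (m - 1) = 0 := hN _ (by omega)
       simp [mf, this]⟩⟩

/-- `R_α : a(x) ↦ a(αx)`, on modes `(R_α a)_m = α^{-m-1} a_m`. -/
def RaE (α : ℂˣ) (a : EW W) : EW W :=
  ⟨{ toFun := fun w m => ((α : ℂ) ^ (-m - 1 : ℤ)) • mf a w m
     map_add' := by intro w w'; funext m; simp [mf, map_add]
     map_smul' := by
       intro c w; funext m
       simp only [mf, map_smul, Pi.smul_apply, RingHom.id_apply]
       exact smul_comm _ _ _ },
   by
     intro w
     obtain ⟨N, hN⟩ := a.2 w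
     exact ⟨N, fun m hm => by simp [mf, hN m hm]⟩⟩

/-! ### Nonlocal vertex algebras, modules and quasi modules -/

/-- The coefficient of `x₀^a x₂^b` in `Y₁(u, x₀+x₂) (Y₂(v,x₂) w)`, where
`(x₀+x₂)^m` is expanded in nonnegative powers of `x₂`. -/
def prodCE {V : Type*} (Yo Yi : V → W → ℤ → W) (u v : V) (w : W) (a b : ℤ) : W :=
  ∑ᶠ m : ℤ, if a ≤ m then
    binom m (m - a).toNat • Yo u (Yi v w (-(b - (m - a)) - 1)) (-m - 1) else 0

/-- The coefficient of `x₀^a x₂^b` in `Y₂(Y₁(u,x₀)v, x₂) w`. -/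
def assocCE {V : Type*} (Y1 : V → V → ℤ → V) (Y2 : V → W → ℤ → W)
    (u v : V) (w : W) (a b : ℤ) : W :=
  Y2 (Y1 u v (-a - 1)) w (-b - 1)

/-- Multiplication of a two-variable family (in `x₀, x₂`) by `f(x₀+x₂, x₂)` for a
polynomial `f`, expanding `(x₀+x₂)^d` in nonnegative powers of `x₂`. -/
def mulSubPoly (f : MvPolynomial (Fin 2) ℂ) (A : ℤ → ℤ → W) (a b : ℤ) : W :=
  ∑ d ∈ f.support, ∑ i ∈ Finset.range (d 0 + 1),
    (MvPolynomial.coeff d f * ((d 0).choose i : ℂ)) •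
      A (a - ((d 0 : ℤ) - i)) (b - i - (d 1 : ℤ))

/-- A nonlocal vertex algebra structure on a ℂ-vector space `V`:
a linear map `Y : V → ℰ(V) = Hom(V, V((x)))` and a vacuum vector `1` such that
`Y(1,x)v = v`, `Y(v,x)1 ∈ V[[x]]` with constant term `v`, and weak associativity
holds. -/
structure NLVA (V : Type*) [AddCommGroup V] [Module ℂ V] where
  Y : V →ₗ[ℂ] EW V
  one : V
  vac : ∀ (v : V) (n : ℤ), mf (Y one) v n = if n = -1 then v else 0
  creation0 : ∀ (v : V) (n : ℤ), 0 ≤ n → mf (Y v) one n = 0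
  creation1 : ∀ v : V, mf (Y v) one (-1) = v
  wassoc : ∀ u v w : V, ∃ l : ℕ, ∀ a b : ℤ,
    mulSubPoly (MvPolynomial.X 0 ^ l)
      (prodCE (fun x => mf (Y x)) (fun x => mf (Y x)) u v w) a b =
    mulSubPoly (MvPolynomial.X 0 ^ l)
      (assocCE (fun x y n => mf (Y x) y n) (fun x => mf (Y x)) u v w) a b

/-- The mode maps of a nonlocal vertex algebra: `Yf A u v n = u_n v`. -/
def Yf {V : Type*} [AddCommGroup V] [Module ℂ V] (A : NLVA V) : V → V → ℤ → V :=
  fun u v n => mf (A.Y u) v n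

/-- Mode maps of a linear map `V → ℰ(W)`. -/
def YWf {V : Type*} [AddCommGroup V] [Module ℂ V] (YW : V →ₗ[ℂ] EW W) :
    V → W → ℤ → W := fun v w n => mf (YW v) w n

/-- `(W, Y_W)` is a quasi module for the nonlocal vertex algebra `A` on `V`. -/
def IsQuasiModule {V : Type*} [AddCommGroup V] [Module ℂ V] (A : NLVA V)
    (YW : V →ₗ[ℂ] EW W) : Prop :=
  (∀ (w : W) (n : ℤ), mf (YW A.one) w n = if n = -1 then w else 0) ∧
  ∀ (u v : V) (w : W), ∃ f : MvPolynomial (Fin 2) ℂ, f ≠ 0 ∧ ∀ a b : ℤ,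
    mulSubPoly f (prodCE (YWf YW) (YWf YW) u v w) a b =
    mulSubPoly f (assocCE (Yf A) (YWf YW) u v w) a b

/-- `(W, Y_W)` is a module for the nonlocal vertex algebra `A` on `V`. -/
def IsModule {V : Type*} [AddCommGroup V] [Module ℂ V] (A : NLVA V)
    (YW : V →ₗ[ℂ] EW W) : Prop :=
  (∀ (w : W) (n : ℤ), mf (YW A.one) w n = if n = -1 then w else 0) ∧
  ∀ (u v : V) (w : W), ∃ l : ℕ, ∀ a b : ℤ,
    mulSubPoly (MvPolynomial.X 0 ^ l) (prodCE (YWf YW) (YWf YW) u v w) a b =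
    mulSubPoly (MvPolynomial.X 0 ^ l) (assocCE (Yf A) (YWf YW) u v w) a b

end NVA

namespace NVA

open MvPolynomial

section PolynomialAction

variable {W : Type*} [AddCommGroup W] [Module ℂ W]

theorem mulPoly_eq_sum (p : MvPolynomial (Fin 2) ℂ) {s : Finset (Fin 2 →₀ ℕ)}
    (hs : p.support ⊆ s) (F : ℤ → ℤ → W) (m t : ℤ) :
    mulPoly p F m t = ∑ d ∈ s, coeff d p • F (m - d 0) (t - d 1) := by
  refine Finset.sum_subset hs fun d _ hd => ?_
  rw [notMem_support_iff.mp hd, zero_smul]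

theorem mulPoly_add_left (p q : MvPolynomial (Fin 2) ℂ) (F : ℤ → ℤ → W) :
    mulPoly (p + q) F = mulPoly p F + mulPoly q F := by
  funext m t
  have h := support_add (p := p) (q := q)
  simp only [Pi.add_apply]
  rw [mulPoly_eq_sum _ h, mulPoly_eq_sum p Finset.subset_union_left,
    mulPoly_eq_sum q Finset.subset_union_right, ← Finset.sum_add_distrib]
  simp only [coeff_add, add_smul]

theorem mulPoly_monomial (d : Fin 2 →₀ ℕ) (c : ℂ) (F : ℤ → ℤ → W) (m t : ℤ) :
    mulPoly (monomial d c) F m t = c • F (m - d 0) (t - d 1) := by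
  rw [mulPoly_eq_sum _ support_monomial_subset]
  simp

theorem mulPoly_C (c : ℂ) (F : ℤ → ℤ → W) : mulPoly (C c) F = c • F := by
  funext m t
  rw [← monomial_zero', mulPoly_monomial]
  simp

theorem mulPoly_X_zero (F : ℤ → ℤ → W) (m t : ℤ) : mulPoly (X 0) F m t = F (m - 1) t := by
  rw [X, mulPoly_monomial]
  simp

theorem mulPoly_X_one (F : ℤ → ℤ → W) (m t : ℤ) : mulPoly (X 1) F m t = F m (t - 1) := by
  rw [X, mulPoly_monomial]
  simp

theorem mulPoly_add_right (p : MvPolynomial (Fin 2) ℂ) (F G : ℤ → ℤ → W) :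
    mulPoly p (F + G) = mulPoly p F + mulPoly p G := by
  funext m t
  simp [mulPoly, Finset.sum_add_distrib]

theorem mulPoly_smul_right (p : MvPolynomial (Fin 2) ℂ) (c : ℂ) (F : ℤ → ℤ → W) :
    mulPoly p (c • F) = c • mulPoly p F := by
  funext m t
  simp [mulPoly, Finset.smul_sum, smul_comm c]

theorem mulPoly_monomial_mul (d : Fin 2 →₀ ℕ) (c : ℂ) (q : MvPolynomial (Fin 2) ℂ)
    (F : ℤ → ℤ → W) :
    mulPoly (monomial d c * q) F = mulPoly (monomial d c) (mulPoly q F) := by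
  induction q using MvPolynomial.induction_on' with
  | monomial e a =>
    funext m t
    rw [monomial_mul, mulPoly_monomial, mulPoly_monomial, mulPoly_monomial, smul_smul]
    simp [sub_sub]
  | add p q hp hq =>
    rw [mul_add, mulPoly_add_left, hp, hq, mulPoly_add_left, mulPoly_add_right]

theorem mulPoly_mul (p q : MvPolynomial (Fin 2) ℂ) (F : ℤ → ℤ → W) :
    mulPoly (p * q) F = mulPoly p (mulPoly q F) := by
  induction p using MvPolynomial.induction_on' with
  | monomial d c => exact mulPoly_monomial_mul d c q F
  | add p p' hp hp' => rw [add_mul, mulPoly_add_left, hp, hp', mulPoly_add_left]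

/-- The substitution `f(x₁,x₂) ↦ f(x₀+x₂,x₂)`. -/
def substAdd : MvPolynomial (Fin 2) ℂ →ₐ[ℂ] MvPolynomial (Fin 2) ℂ :=
  aeval ![X 0 + X 1, X 1]

theorem substAdd_injective : Function.Injective substAdd := by
  have h : Function.LeftInverse (aeval ![X 0 - X 1, X 1]) substAdd := fun p => by
    induction p using MvPolynomial.induction_on with
    | C c => simp [substAdd, algebraMap_eq]
    | add p q hp hq => rw [map_add, map_add, hp, hq]
    | mul_X p i hp =>
      rw [map_mul, map_mul, hp]
      fin_cases i <;> simp [substAdd]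
  exact h.injective

theorem mulSubPoly_eq_mulPoly (f : MvPolynomial (Fin 2) ℂ) (A : ℤ → ℤ → W) :
    mulSubPoly f A = mulPoly (substAdd f) A := by
  have sum_left : ∀ {ι : Type} (s : Finset ι) (g : ι → MvPolynomial (Fin 2) ℂ) (m t : ℤ),
      mulPoly (∑ i ∈ s, g i) A m t = ∑ i ∈ s, mulPoly (g i) A m t := by
    intro ι s g m t
    induction s using Finset.induction_on with
    | empty => simp [mulPoly]
    | insert i s hi ih =>
      rw [Finset.sum_insert hi, Finset.sum_insert hi, mulPoly_add_left, ← ih]; rfl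
  funext a b
  conv_rhs => rw [f.as_sum, map_sum, sum_left]
  refine Finset.sum_congr rfl fun d _ => ?_
  have h : substAdd (monomial d (coeff d f)) = ∑ i ∈ Finset.range (d 0 + 1),
      monomial (Finsupp.single 0 (d 0 - i) + Finsupp.single 1 (i + d 1))
        (coeff d f * ((d 0).choose i : ℂ)) := by
    rw [substAdd, aeval_monomial, Finsupp.prod_fintype _ _ (by simp), Fin.prod_univ_two]
    simp only [Matrix.cons_val_zero, Matrix.cons_val_one]
    rw [add_comm (X 0), add_pow, Finset.sum_mul, Finset.mul_sum]
    refine Finset.sum_congr rfl fun i _ => ?_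
    rw [monomial_eq, Finsupp.prod_fintype _ _ (by simp), Fin.prod_univ_two]
    simp [pow_add, algebraMap_eq]
    ring
  rw [h, sum_left]
  refine Finset.sum_congr rfl fun i hi => ?_
  have hi' : i ≤ d 0 := by simpa [Nat.lt_succ_iff] using hi
  rw [mulPoly_monomial]
  simp [Nat.cast_sub hi', sub_sub]

end PolynomialAction

section Binomial

/-- The binomial coefficient `C(m, a)` for `m, a ∈ ℤ`, zero for negative `a`. -/
def binomInt (m a : ℤ) : ℂ := if 0 ≤ a then binom m a.toNat else 0

theorem binom_add_one (m : ℤ) (j : ℕ) :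
    binom (m + 1) (j + 1) = binom m (j + 1) + binom m j := by
  have h : ∏ i ∈ Finset.range (j + 1), (((m + 1 : ℤ) : ℂ) - (i : ℂ)) =
      (∏ i ∈ Finset.range j, ((m : ℂ) - (i : ℂ))) * (m + 1) := by
    rw [Finset.prod_range_succ']
    simp
  have hj : (j.factorial : ℂ) ≠ 0 := by exact_mod_cast j.factorial_ne_zero
  have hj' : (j : ℂ) + 1 ≠ 0 := by exact_mod_cast j.succ_ne_zero
  rw [binom, h, binom, binom, Finset.prod_range_succ, Nat.factorial_succ]
  push_cast
  field_simp
  ring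

theorem binomInt_add_one (m a : ℤ) :
    binomInt (m + 1) a = binomInt m a + binomInt m (a - 1) := by
  rcases lt_trichotomy a 0 with h | rfl | h
  · simp [binomInt, show ¬ 0 ≤ a by omega, show ¬ 1 ≤ a by omega]
  · simp [binomInt, binom]
  · obtain ⟨j, rfl⟩ : ∃ j : ℕ, a = j + 1 := ⟨(a - 1).toNat, by omega⟩
    have : ((j : ℤ) + 1).toNat = j + 1 := by omega
    simp [binomInt, this, binom_add_one, show (0 : ℤ) ≤ j + 1 by omega]

theorem binom_natCast (n j : ℕ) : binom n j = n.choose j := by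
  induction n generalizing j with
  | zero =>
    cases j with
    | zero => simp [binom]
    | succ j => simp [binom, Finset.prod_range_succ']
  | succ n ih =>
    cases j with
    | zero => simp [binom]
    | succ j =>
      push_cast
      rw [binom_add_one, ih, ih, Nat.choose_succ_succ]
      push_cast
      ring

theorem binomInt_symm {m : ℤ} (hm : 0 ≤ m) (a : ℤ) : binomInt m (m - a) = binomInt m a := by
  lift m to ℕ using hm
  by_cases ha : 0 ≤ a
  · lift a to ℕ using ha
    by_cases h : a ≤ m
    · have : ((m : ℤ) - a).toNat = m - a := by omega
      simp [binomInt, this, binom_natCast, h, Nat.choose_symm h]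
    · simp [binomInt, binom_natCast, h, Nat.choose_eq_zero_of_lt (not_le.mp h)]
  · have h : m < ((m : ℤ) - a).toNat := by omega
    simp [binomInt, ha, binom_natCast, Nat.choose_eq_zero_of_lt h]

end Binomial

section KernelSubstitution

variable {W : Type*} [AddCommGroup W] [Module ℂ W]

/-- The substitution `x₁^m ↦ ∑ₐ K(m,a) x₀^a x₂^(m-a)`, applied to `∑ F(m,t) x₁^m x₂^t`;
for the kernels used here this expands `(x₀+x₂)^m` in nonnegative powers of `x₂` or `x₀`. -/
def kerSubst (K : ℤ → ℤ → ℂ) (F : ℤ → ℤ → W) : ℤ → ℤ → W :=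
  fun a b => ∑ᶠ m : ℤ, K m a • F m (b - m + a)

/-- All the sums defining `kerSubst K F` are finite. -/
def KerFinite (K : ℤ → ℤ → ℂ) (F : ℤ → ℤ → W) : Prop :=
  ∀ a b : ℤ, {m : ℤ | K m a • F m (b - m + a) ≠ 0}.Finite

variable {K : ℤ → ℤ → ℂ} {F G : ℤ → ℤ → W}

theorem KerFinite.add (hF : KerFinite K F) (hG : KerFinite K G) : KerFinite K (F + G) := by
  intro a b
  refine ((hF a b).union (hG a b)).subset fun m hm => ?_
  by_contra h
  simp only [Set.mem_union, Set.mem_ofPred_eq, not_or, not_not] at h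
  exact hm (by simp [smul_add, h.1, h.2])

theorem kerSubst_add (hF : KerFinite K F) (hG : KerFinite K G) :
    kerSubst K (F + G) = kerSubst K F + kerSubst K G := by
  funext a b
  simp only [kerSubst, Pi.add_apply, smul_add]
  exact finsum_add_distrib (hF a b) (hG a b)

theorem KerFinite.const_smul (c : ℂ) (hF : KerFinite K F) : KerFinite K (c • F) := by
  intro a b
  refine (hF a b).subset fun m hm h => hm ?_
  simp only [Pi.smul_apply]
  rw [smul_comm, h, smul_zero]

theorem kerSubst_smul (c : ℂ) (F : ℤ → ℤ → W) : kerSubst K (c • F) = c • kerSubst K F := by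
  funext a b
  simp only [kerSubst, Pi.smul_apply, smul_finsum, smul_comm c]

theorem KerFinite.mulPoly_X_one (hF : KerFinite K F) : KerFinite K (mulPoly (X 1) F) := by
  intro a b
  refine (hF a (b - 1)).subset fun m hm => ?_
  simpa only [Set.mem_ofPred_eq, NVA.mulPoly_X_one,
    show b - m + a - 1 = b - 1 - m + a by ring] using hm

theorem kerSubst_mulPoly_X_one (F : ℤ → ℤ → W) :
    kerSubst K (mulPoly (X 1) F) = mulPoly (X 1) (kerSubst K F) := by
  funext a b
  simp only [kerSubst, mulPoly_X_one, show ∀ m, b - m + a - 1 = b - 1 - m + a by intro m; ring]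

variable (hK : ∀ m a, K (m + 1) a = K m a + K m (a - 1))

include hK in
theorem smul_mulPoly_X_zero (F : ℤ → ℤ → W) (a b m : ℤ) :
    K (m + 1) a • mulPoly (X 0) F (m + 1) (b - (m + 1) + a) =
      K m a • F m (b - 1 - m + a) + K m (a - 1) • F m (b - m + (a - 1)) := by
  rw [hK, NVA.mulPoly_X_zero, add_smul, add_sub_cancel_right,
    show b - (m + 1) + a = b - 1 - m + a by ring, show b - m + (a - 1) = b - 1 - m + a by ring]

include hK in
theorem KerFinite.mulPoly_X_zero (hF : KerFinite K F) : KerFinite K (mulPoly (X 0) F) := by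
  intro a b
  refine (((hF a (b - 1)).union (hF (a - 1) b)).image (· + 1)).subset fun m hm => ?_
  refine ⟨m - 1, ?_, by simp⟩
  by_contra h
  simp only [Set.mem_union, Set.mem_ofPred_eq, not_or, not_not] at h
  have := smul_mulPoly_X_zero hK F a b (m - 1)
  rw [h.1, h.2, sub_add_cancel, add_zero] at this
  exact hm this

include hK in
theorem kerSubst_mulPoly_X_zero (hF : KerFinite K F) :
    kerSubst K (mulPoly (X 0) F) = mulPoly (X 0 + X 1) (kerSubst K F) := by
  funext a b
  rw [mulPoly_add_left, Pi.add_apply, Pi.add_apply, mulPoly_X_zero, mulPoly_X_one]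
  simp only [kerSubst]
  rw [← finsum_comp_equiv (Equiv.addRight (1 : ℤ))]
  simp only [Equiv.coe_addRight, smul_mulPoly_X_zero hK]
  rw [finsum_add_distrib (hF a (b - 1)) (hF (a - 1) b), add_comm]

include hK in
theorem kerSubst_mulPoly (f : MvPolynomial (Fin 2) ℂ) (hF : KerFinite K F) :
    KerFinite K (mulPoly f F) ∧
      kerSubst K (mulPoly f F) = mulPoly (substAdd f) (kerSubst K F) := by
  induction f using MvPolynomial.induction_on generalizing F with
  | C c =>
    have h : substAdd (C c) = C c := by simp [substAdd, algebraMap_eq]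
    rw [h, mulPoly_C, mulPoly_C]
    exact ⟨hF.const_smul c, kerSubst_smul c F⟩
  | add p q hp hq =>
    rw [mulPoly_add_left, map_add, mulPoly_add_left, ← (hp hF).2, ← (hq hF).2]
    exact ⟨(hp hF).1.add (hq hF).1, kerSubst_add (hp hF).1 (hq hF).1⟩
  | mul_X p i hp =>
    rw [mulPoly_mul, map_mul, mulPoly_mul]
    have h : KerFinite K (mulPoly (X i) F) ∧
        kerSubst K (mulPoly (X i) F) = mulPoly (substAdd (X i)) (kerSubst K F) := by
      fin_cases i
      · exact ⟨hF.mulPoly_X_zero hK, by simpa [substAdd] using kerSubst_mulPoly_X_zero hK hF⟩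
      · exact ⟨hF.mulPoly_X_one, by simpa [substAdd] using kerSubst_mulPoly_X_one F⟩
    rw [← h.2]
    exact hp h.1

/-- The kernel expanding `(x₀+x₂)^m` in nonnegative powers of `x₂`. -/
def kerProd (m a : ℤ) : ℂ := binomInt m (m - a)

theorem kerProd_add_one (m a : ℤ) : kerProd (m + 1) a = kerProd m a + kerProd m (a - 1) := by
  rw [kerProd, binomInt_add_one, kerProd, kerProd, add_comm]
  congr 2 <;> ring

theorem kerFinite_kerProd {t₀ : ℤ} (hF : ∀ m t, t < t₀ → F m t = 0) : KerFinite kerProd F := by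
  intro a b
  refine (Set.finite_Icc a (b + a - t₀)).subset fun m hm => ?_
  refine ⟨?_, ?_⟩
  · by_contra h
    exact hm (by rw [kerProd, binomInt, if_neg (by omega), zero_smul])
  · by_contra h
    exact hm (by rw [hF _ _ (by omega), smul_zero])

theorem kerFinite_binomInt (hF : IsLaurent2 F) : KerFinite binomInt F := by
  obtain ⟨N, hN⟩ := hF
  intro a b
  refine (Set.finite_Icc N (b + a - N)).subset fun m hm => ?_
  refine ⟨?_, ?_⟩ <;>
  · by_contra h
    exact hm (by rw [hN _ _ (by omega), smul_zero])

theorem kerSubst_kerProd_eq (hF : ∀ m t, m < 0 → F m t = 0) :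
    kerSubst kerProd F = kerSubst binomInt F := by
  funext a b
  refine finsum_congr fun m => ?_
  by_cases hm : m < 0
  · rw [hF _ _ hm, smul_zero, smul_zero]
  · rw [kerProd, binomInt_symm (not_lt.mp hm)]

theorem mulPoly_eq_zero_of_lt (f : MvPolynomial (Fin 2) ℂ) {N : ℤ}
    (hF : ∀ m t, m < N → F m t = 0) (m t : ℤ) (hm : m < N) : mulPoly f F m t = 0 :=
  Finset.sum_eq_zero fun d _ => by rw [hF _ _ (by omega), smul_zero]

theorem mulPoly_X_zero_pow (k : ℕ) (F : ℤ → ℤ → W) (m t : ℤ) :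
    mulPoly (X 0 ^ k) F m t = F (m - k) t := by
  rw [X_pow_eq_monomial, mulPoly_monomial]
  simp

end KernelSubstitution

section LaurentModule

/-- Laurent series with coefficients in an `R`-module `M`, as a module over `R((x))`. -/
def LaurentMod (R M : Type*) [CommRing R] [AddCommGroup M] [Module R M] : Type _ :=
  HahnModule ℤ R M

namespace LaurentMod

variable {R M : Type*} [CommRing R] [AddCommGroup M] [Module R M]

instance : AddCommGroup (LaurentMod R M) := inferInstanceAs <| AddCommGroup (HahnModule ℤ R M)

instance : Module (HahnSeries ℤ R) (LaurentMod R M) :=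
  inferInstanceAs <| Module (HahnSeries ℤ R) (HahnModule ℤ R M)

/-- The coefficient function of a Laurent series. -/
def coeff (z : LaurentMod R M) : ℤ → M := ((HahnModule.of R).symm z).coeff

@[ext]
theorem ext {z z' : LaurentMod R M} (h : ∀ a, z.coeff a = z'.coeff a) : z = z' :=
  HahnModule.ext z z' (funext h)

theorem coeff_add (z z' : LaurentMod R M) (a : ℤ) :
    (z + z').coeff a = z.coeff a + z'.coeff a := rfl

theorem coeff_zero (a : ℤ) : (0 : LaurentMod R M).coeff a = 0 := rfl

theorem exists_coeff_eq {A : ℤ → M} {N : ℤ} (hA : ∀ a < N, A a = 0) :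
    ∃ z : LaurentMod R M, z.coeff = A :=
  ⟨HahnModule.of R (HahnSeries.ofSuppBddBelow A
    ⟨N, fun a ha => not_lt.mp fun h => ha (hA a h)⟩), rfl⟩

theorem exists_coeff_eq_zero (z : LaurentMod R M) : ∃ N : ℤ, ∀ a < N, z.coeff a = 0 :=
  ⟨((HahnModule.of R).symm z).order, fun _ h => HahnSeries.coeff_eq_zero_of_lt_order h⟩

theorem finite_smul_coeff (q : HahnSeries ℤ R) (z : LaurentMod R M) (a : ℤ) :
    {s : ℤ | q.coeff s ≠ 0 ∧ z.coeff (a - s) ≠ 0}.Finite := by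
  refine ((Set.VAddAntidiagonal.finite_of_isPWO q.isPWO_support
    ((HahnModule.of R).symm z).isPWO_support a).image Prod.fst).subset fun s hs => ?_
  exact ⟨(s, a - s), ⟨hs.1, hs.2, by simp⟩, rfl⟩

theorem coeff_smul (q : HahnSeries ℤ R) (z : LaurentMod R M) (a : ℤ) :
    (q • z).coeff a = ∑ᶠ s : ℤ, q.coeff s • z.coeff (a - s) := by
  refine (HahnModule.coeff_smul q (show HahnModule ℤ R M from z) a).trans ?_
  rw [finsum_eq_sum_of_support_subset (s := (finite_smul_coeff q z a).toFinset)]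
  · refine Finset.sum_bij (fun ij _ => ij.1) ?_ ?_ ?_ ?_
    · rintro ⟨i, j⟩ h
      obtain ⟨h₁, h₂, h₃⟩ := (Finset.mem_vaddAntidiagonal _ _).1 h
      obtain rfl : a - i = j := by rw [← h₃]; simp
      simpa using ⟨h₁, h₂⟩
    · rintro ⟨i, j⟩ h ⟨i', j'⟩ h' hii
      obtain ⟨-, -, h₃⟩ := (Finset.mem_vaddAntidiagonal _ _).1 h
      obtain ⟨-, -, h₃'⟩ := (Finset.mem_vaddAntidiagonal _ _).1 h'
      simp only [vadd_eq_add] at h₃ h₃' hii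
      ext <;> simp <;> omega
    · intro s hs
      simp only [Set.Finite.mem_toFinset, Set.mem_ofPred_eq] at hs
      exact ⟨(s, a - s), (Finset.mem_vaddAntidiagonal _ _).2 ⟨hs.1, hs.2, by simp⟩, rfl⟩
    · rintro ⟨i, j⟩ h
      obtain ⟨-, -, h₃⟩ := (Finset.mem_vaddAntidiagonal _ _).1 h
      obtain rfl : a - i = j := by rw [← h₃]; simp
      rfl
  · intro s hs
    simp only [Set.Finite.coe_toFinset, Set.mem_ofPred_eq]
    exact ⟨fun h => hs (by simp only [h, zero_smul]), fun h => hs (by simp only [h, smul_zero])⟩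

protected theorem mul_smul (p q : HahnSeries ℤ R) (z : LaurentMod R M) :
    (p * q) • z = p • q • z := mul_smul p q z

protected theorem zero_smul (z : LaurentMod R M) : (0 : HahnSeries ℤ R) • z = 0 := zero_smul _ z

protected theorem one_smul (z : LaurentMod R M) : (1 : HahnSeries ℤ R) • z = z := one_smul _ z

theorem coeff_single_smul (i : ℤ) (r : R) (z : LaurentMod R M) (a : ℤ) :
    (HahnSeries.single i r • z).coeff a = r • z.coeff (a - i) := by
  rw [coeff_smul, finsum_eq_single _ i, HahnSeries.coeff_single_same]
  intro s hs
  rw [HahnSeries.coeff_single_of_ne hs, zero_smul]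

end LaurentMod

variable (W : Type*) [AddCommGroup W] [Module ℂ W]

/-- `W((x))((x₀))` as a module over `ℂ((x))((x₀))`. -/
abbrev LaurentMod₂ : Type _ := LaurentMod LC (LaurentMod ℂ W)

variable {W}

/-- The coefficient of `x₀^a x^b` in an element of `W((x))((x₀))`. -/
def coeff₂ (z : LaurentMod₂ W) (a b : ℤ) : W := (z.coeff a).coeff b

theorem coeff₂_injective : Function.Injective (coeff₂ (W := W)) := fun _ _ h =>
  LaurentMod.ext fun a => LaurentMod.ext fun b => congrFun (congrFun h a) b

theorem coeff₂_add (z z' : LaurentMod₂ W) : coeff₂ (z + z') = coeff₂ z + coeff₂ z' := rfl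

theorem coeff₂_zero : coeff₂ (0 : LaurentMod₂ W) = 0 := rfl

theorem exists_coeff₂_eq {A : ℤ → ℤ → W} {N : ℤ} (hN : ∀ a b, a < N → A a b = 0)
    (hA : ∀ a, ∃ M : ℤ, ∀ b < M, A a b = 0) : ∃ z : LaurentMod₂ W, coeff₂ z = A := by
  have h : ∀ a, ∃ y : LaurentMod ℂ W, y.coeff = A a := fun a =>
    (hA a).elim fun _ hM => LaurentMod.exists_coeff_eq hM
  choose y hy using h
  obtain ⟨z, hz⟩ := LaurentMod.exists_coeff_eq (R := LC) (A := y) (N := N) fun a ha =>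
    LaurentMod.ext fun b => by rw [hy, hN a b ha, LaurentMod.coeff_zero]
  exact ⟨z, by funext a b; rw [coeff₂, hz, hy]⟩

theorem coeff₂_smul (q : K2) (z : LaurentMod₂ W) (a b : ℤ) :
    coeff₂ (q • z) a b =
      ∑ᶠ s : ℤ × ℤ, (q.coeff s.1).coeff s.2 • coeff₂ z (a - s.1) (b - s.2) := by
  let ev : LaurentMod ℂ W →+ W :=
    { toFun := fun y => y.coeff b
      map_zero' := rfl
      map_add' := fun _ _ => rfl }
  have h₁ := LaurentMod.finite_smul_coeff q z a
  rw [finsum_curry]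
  · have h : coeff₂ (q • z) a b = ev ((q • z).coeff a) := rfl
    rw [h, LaurentMod.coeff_smul, AddMonoidHom.map_finsum]
    · exact finsum_congr fun s => LaurentMod.coeff_smul _ _ b
    · refine h₁.subset fun s hs => ?_
      exact ⟨fun h => hs ((congrArg (· • _) h).trans (LaurentMod.zero_smul _)),
        fun h => hs (by simp only [h, smul_zero])⟩
  · refine (h₁.biUnion fun s _ => (Set.finite_singleton s).prod
      (LaurentMod.finite_smul_coeff (q.coeff s) (z.coeff (a - s)) b)).subset ?_
    rintro ⟨s, s'⟩ hs
    simp only [Function.mem_support] at hs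
    simp only [Set.mem_iUnion]
    refine ⟨s, ⟨fun h => hs ?_, fun h => hs ?_⟩, rfl, fun h => hs ?_, fun h => hs ?_⟩
    · simp [h]
    · simp [coeff₂, h, LaurentMod.coeff_zero]
    · simp [h]
    · simp only [coeff₂, h, smul_zero]

theorem coeff₂_single_smul (i j : ℤ) (c : ℂ) (z : LaurentMod₂ W) (a b : ℤ) :
    coeff₂ ((HahnSeries.single i (HahnSeries.single j c) : K2) • z) a b =
      c • coeff₂ z (a - i) (b - j) := by
  rw [coeff₂, LaurentMod.coeff_single_smul, LaurentMod.coeff_single_smul, coeff₂]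

theorem coeff₂_xOuter_smul (z : LaurentMod₂ W) :
    coeff₂ (xOuter • z) = mulPoly (X 0) (coeff₂ z) := by
  funext a b
  have h : xOuter = HahnSeries.single 1 (HahnSeries.single 0 1) := rfl
  rw [h, coeff₂_single_smul, mulPoly_X_zero, one_smul, sub_zero]

theorem coeff₂_xInner_smul (z : LaurentMod₂ W) :
    coeff₂ (xInner • z) = mulPoly (X 1) (coeff₂ z) := by
  funext a b
  rw [xInner, coeff₂_single_smul, mulPoly_X_one, one_smul, sub_zero]

theorem add_smul₂ (p q : K2) (z : LaurentMod₂ W) : (p + q) • z = p • z + q • z :=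
  add_smul p q z

theorem mul_smul₂ (p q : K2) (z : LaurentMod₂ W) : (p * q) • z = p • q • z :=
  LaurentMod.mul_smul p q z

theorem zero_smul₂ (z : LaurentMod₂ W) : (0 : K2) • z = 0 :=
  LaurentMod.zero_smul z

theorem one_smul₂ (z : LaurentMod₂ W) : (1 : K2) • z = z :=
  LaurentMod.one_smul z

theorem qK_mul (p q : MvPolynomial (Fin 2) ℂ) (α : ℂ) : qK (p * q) α = qK p α * qK q α :=
  map_mul _ _ _

theorem qK_C (c α : ℂ) : qK (C c) α = HahnSeries.single 0 (HahnSeries.single 0 c) := by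
  rw [qK, aeval_C, HahnSeries.algebraMap_apply', PowerSeries.algebraMap_apply,
    HahnSeries.algebraMap_apply', PowerSeries.algebraMap_apply, HahnSeries.ofPowerSeries_C, HahnSeries.ofPowerSeries_C]
  rfl

theorem coeff₂_qK_smul (f : MvPolynomial (Fin 2) ℂ) (z : LaurentMod₂ W) :
    coeff₂ (qK f 1 • z) = mulPoly (substAdd f) (coeff₂ z) := by
  induction f using MvPolynomial.induction_on generalizing z with
  | C c =>
    have h : substAdd (C c) = C c := by simp [substAdd, algebraMap_eq]
    funext a b
    rw [h, mulPoly_C, qK_C, coeff₂_single_smul, sub_zero, sub_zero, Pi.smul_apply, Pi.smul_apply]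
  | add p q hp hq =>
    rw [show qK (p + q) 1 = qK p 1 + qK q 1 from map_add _ _ _, add_smul₂, coeff₂_add, hp, hq,
      map_add, mulPoly_add_left]
  | mul_X p i hp =>
    rw [qK_mul, mul_smul₂, hp, map_mul, mulPoly_mul]
    congr 1
    fin_cases i
    · have h : qK (X 0) 1 = xOuter + xInner := by simp [qK, xInnerC, xInner]
      have h' : substAdd (X 0) = X 0 + X 1 := by simp [substAdd]
      simp only [Fin.zero_eta, h, h', add_smul₂, coeff₂_add, coeff₂_xOuter_smul,
        coeff₂_xInner_smul, mulPoly_add_left]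
    · have h : qK (X 1) 1 = xInner := by simp [qK]
      have h' : substAdd (X 1) = X 1 := by simp [substAdd]
      simp only [Fin.mk_one, h, h', coeff₂_xInner_smul]

theorem qK_ne_zero {f : MvPolynomial (Fin 2) ℂ} (hf : f ≠ 0) : qK f 1 ≠ 0 := by
  intro h
  let δ : ℤ → ℤ → ℂ := fun a b => if a = 0 ∧ b = 0 then 1 else 0
  obtain ⟨z, hz⟩ : ∃ z : LaurentMod₂ ℂ, coeff₂ z = δ :=
    exists_coeff₂_eq (N := 0) (fun a b ha => if_neg (by omega))
      fun a => ⟨0, fun b hb => if_neg (by omega)⟩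
  have h₀ := coeff₂_qK_smul f z
  rw [h, zero_smul₂, coeff₂_zero, hz] at h₀
  refine hf (substAdd_injective ?_)
  rw [map_zero]
  ext d
  have h₁ := congrFun (congrFun h₀ (d 0)) (d 1)
  rw [mulPoly_eq_sum _ (Finset.subset_insert d _), Finset.sum_eq_single d] at h₁
  · simpa [δ] using h₁.symm
  · intro e _ he
    rw [show δ _ _ = 0 from if_neg fun h => he ?_, smul_zero]
    ext i
    fin_cases i <;> simp <;> omega
  · simp

end LaurentModule

section VertexOperation

variable {W : Type*} [AddCommGroup W] [Module ℂ W]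

theorem mf_injective : Function.Injective (mf (W := W)) := fun _ _ h =>
  Subtype.ext (LinearMap.ext fun w => congrFun h w)

theorem mf_add (a : EW W) (w w' : W) (n : ℤ) : mf a (w + w') n = mf a w n + mf a w' n := by
  simp [mf]

theorem mf_smul (a : EW W) (c : ℂ) (w : W) (n : ℤ) : mf a (c • w) n = c • mf a w n := by
  simp [mf]

theorem mf_zero (a : EW W) (n : ℤ) : mf a 0 n = 0 := by
  simp [mf]

theorem exists_mf_eq_zero (a : EW W) (w : W) : ∃ N : ℤ, ∀ n, N ≤ n → mf a w n = 0 := a.2 w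

theorem Fab_add (a b : EW W) (w w' : W) : Fab a b (w + w') = Fab a b w + Fab a b w' := by
  funext m t
  simp only [Fab, mf_add, Pi.add_apply]

theorem Fab_smul (a b : EW W) (c : ℂ) (w : W) : Fab a b (c • w) = c • Fab a b w := by
  funext m t
  simp only [Fab, mf_smul, Pi.smul_apply]

theorem exists_Fab_eq_zero (a b : EW W) (w : W) : ∃ t₀ : ℤ, ∀ m t, t < t₀ → Fab a b w m t = 0 := by
  obtain ⟨N, hN⟩ := exists_mf_eq_zero b w
  exact ⟨-N, fun m t ht => by rw [Fab, hN _ (by omega), mf_zero]⟩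

theorem exists_coeff₂_eq_kerSubst {G : ℤ → ℤ → W} (hG : IsLaurent2 G) :
    ∃ z : LaurentMod₂ W, coeff₂ z = kerSubst binomInt G := by
  obtain ⟨N, hN⟩ := hG
  refine exists_coeff₂_eq (N := 0) (fun a b ha => ?_) fun a => ⟨2 * N - a, fun b hb => ?_⟩
  · simp [kerSubst, binomInt, not_le.mpr ha]
  · refine finsum_eq_zero_of_forall_eq_zero fun m => ?_
    rw [hN m (b - m + a) (by omega), smul_zero]

theorem fullYE_eq_coeff₂ {p : MvPolynomial (Fin 2) ℂ} {a b : EW W} {w : W} {z : LaurentMod₂ W}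
    (hz : coeff₂ z = kerSubst binomInt (mulPoly p (Fab a b w))) :
    fullYE 1 p a b w = coeff₂ (qInv p 1 • z) := by
  funext J T
  rw [coeff₂_smul, fullYE]
  refine finsum_congr fun s => ?_
  rw [hz]
  congr 1
  by_cases h : 0 ≤ J - s.1
  · rw [if_pos h]
    refine finsum_congr fun m => ?_
    rw [binomInt, if_pos h, one_zpow, mul_one, Int.toNat_of_nonneg h]
  · rw [if_neg h]
    exact (finsum_eq_zero_of_forall_eq_zero fun m => by rw [binomInt, if_neg h, zero_smul]).symm

theorem exists_mf_eq_fullYE {p : MvPolynomial (Fin 2) ℂ} {a b : EW W}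
    (hp : ∀ w, IsLaurent2 (mulPoly p (Fab a b w))) (n : ℤ) :
    ∃ c : EW W, ∀ w m, mf c w m = fullYE 1 p a b w (-n - 1) (-m - 1) := by
  choose z hz using fun w => exists_coeff₂_eq_kerSubst (hp w)
  have z_add : ∀ w w', z (w + w') = z w + z w' := fun w w' => coeff₂_injective <| by
    rw [coeff₂_add, hz, hz, hz, Fab_add, mulPoly_add_right,
      kerSubst_add (kerFinite_binomInt (hp w)) (kerFinite_binomInt (hp w'))]
  have z_smul : ∀ (r : ℂ) w, coeff₂ (z (r • w)) = r • coeff₂ (z w) := fun r w => by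
    rw [hz, hz, Fab_smul, mulPoly_smul_right, kerSubst_smul]
  refine ⟨⟨{ toFun := fun w m => coeff₂ (qInv p 1 • z w) (-n - 1) (-m - 1),
             map_add' := fun w w' => ?_, map_smul' := fun r w => ?_ }, fun w => ?_⟩,
    fun w m => by rw [fullYE_eq_coeff₂ (hz w)]; rfl⟩
  · funext m
    rw [z_add, smul_add, coeff₂_add]
    rfl
  · funext m
    simp only [coeff₂_smul, z_smul, Pi.smul_apply, RingHom.id_apply, smul_finsum, smul_comm r]
  · obtain ⟨N, hN⟩ := LaurentMod.exists_coeff_eq_zero ((qInv p 1 • z w).coeff (-n - 1))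
    exact ⟨-N, fun m hm => hN _ (by omega)⟩

theorem mf_YE {a b : EW W} (h : QCPair a b) (n : ℤ) (w : W) (m : ℤ) :
    mf (YE a b n) w m = fullYE 1 h.choose a b w (-n - 1) (-m - 1) := by
  have hraw : rawYE ((1 : ℂˣ) : ℂ) a b n = fun w m => fullYE 1 h.choose a b w (-n - 1) (-m - 1) := by
    funext w m
    rw [rawYE, dif_pos h, Units.val_one]
  have hc : ∃ c : EW W, ∀ w m, mf c w m = rawYE ((1 : ℂˣ) : ℂ) a b n w m := by
    rw [hraw]
    exact exists_mf_eq_fullYE h.choose_spec.2 n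
  rw [YE, YEa, dif_pos hc, hc.choose_spec, hraw]

/-- Multiplying by a power of `x₁` clears the negative powers of `x₁`, after which both
expansions of `(x₀+x₂)^m` agree. -/
theorem exists_pow_mulPoly_kerSubst_eq {p : MvPolynomial (Fin 2) ℂ} {F : ℤ → ℤ → W} {t₀ : ℤ}
    (hF : ∀ m t, t < t₀ → F m t = 0) (hp : IsLaurent2 (mulPoly p F)) {z : LaurentMod₂ W}
    (hz : coeff₂ z = kerSubst binomInt (mulPoly p F)) :
    ∃ k : ℕ, ∀ f : MvPolynomial (Fin 2) ℂ,
      mulPoly (substAdd (X 0 ^ k * f * p)) (kerSubst kerProd F) =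
        coeff₂ (qK (X 0 ^ k * f) 1 • z) := by
  obtain ⟨N, hN⟩ := id hp
  refine ⟨(-N).toNat, fun f => ?_⟩
  rw [coeff₂_qK_smul, hz, ← (kerSubst_mulPoly kerProd_add_one _ (kerFinite_kerProd hF)).2,
    ← (kerSubst_mulPoly binomInt_add_one _ (kerFinite_binomInt hp)).2, mulPoly_mul _ p]
  refine kerSubst_kerProd_eq fun m t hm => ?_
  rw [mulPoly_mul, mulPoly_X_zero_pow]
  exact mulPoly_eq_zero_of_lt f (fun m t h => hN m t (Or.inl h)) _ _ (by omega)

theorem prodCE_eq_kerSubst {V : Type*} [AddCommGroup V] [Module ℂ V] (YW : V →ₗ[ℂ] EW W)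
    (u v : V) (w : W) :
    prodCE (YWf YW) (YWf YW) u v w = kerSubst kerProd (Fab (YW u) (YW v) w) := by
  funext a b
  refine finsum_congr fun m => ?_
  by_cases h : a ≤ m
  · rw [if_pos h, kerProd, binomInt, if_pos (by omega), Fab, YWf, YWf,
      show b - (m - a) = b - m + a by ring]
  · rw [if_neg h, kerProd, binomInt, if_neg (by omega), zero_smul]

theorem exists_coeff₂_eq_assocCE {V : Type*} [AddCommGroup V] [Module ℂ V] (A : NLVA V)
    (YW : V →ₗ[ℂ] EW W) (u v : V) (w : W) :
    ∃ c : LaurentMod₂ W, coeff₂ c = assocCE (Yf A) (YWf YW) u v w := by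
  obtain ⟨N, hN⟩ := exists_mf_eq_zero (A.Y u) v
  refine exists_coeff₂_eq (N := -N) (fun a b ha => ?_) fun a => ?_
  · have h : Yf A u v (-a - 1) = 0 := hN _ (by omega)
    rw [assocCE, h, YWf, map_zero]
    rfl
  · obtain ⟨M, hM⟩ := exists_mf_eq_zero (YW (Yf A u v (-a - 1))) w
    exact ⟨-M, fun b hb => hM _ (by omega)⟩

theorem hahnSeries_inv_mul_cancel {R : Type*} [Field R] {q : HahnSeries ℤ R} (hq : q ≠ 0) :
    q⁻¹ * q = 1 := inv_mul_cancel₀ hq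

theorem hahnSeries_mul_inv_cancel {R : Type*} [Field R] {q : HahnSeries ℤ R} (hq : q ≠ 0) :
    q * q⁻¹ = 1 := mul_inv_cancel₀ hq

theorem qInv_mul_qK {p : MvPolynomial (Fin 2) ℂ} (hp : p ≠ 0) : qInv p 1 * qK p 1 = 1 :=
  hahnSeries_inv_mul_cancel (qK_ne_zero hp)

theorem qK_mul_qInv {p : MvPolynomial (Fin 2) ℂ} (hp : p ≠ 0) : qK p 1 * qInv p 1 = 1 :=
  hahnSeries_mul_inv_cancel (qK_ne_zero hp)

theorem smul_left_injective_qK {p : MvPolynomial (Fin 2) ℂ} (hp : p ≠ 0) {z z' : LaurentMod₂ W}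
    (h : qK p 1 • z = qK p 1 • z') : z = z' := by
  rw [← one_smul₂ z, ← one_smul₂ z', ← qInv_mul_qK hp, mul_smul₂, mul_smul₂, h]

theorem assocCE_eq_fullYE {V : Type*} [AddCommGroup V] [Module ℂ V] {A : NLVA V}
    {YW : V →ₗ[ℂ] EW W} {u v : V} {w : W} {f p : MvPolynomial (Fin 2) ℂ} (hf : f ≠ 0)
    (h : ∀ a b : ℤ, mulSubPoly f (prodCE (YWf YW) (YWf YW) u v w) a b =
      mulSubPoly f (assocCE (Yf A) (YWf YW) u v w) a b)
    (hp : p ≠ 0) (hL : IsLaurent2 (mulPoly p (Fab (YW u) (YW v) w))) :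
    assocCE (Yf A) (YWf YW) u v w = fullYE 1 p (YW u) (YW v) w := by
  obtain ⟨c, hc⟩ := exists_coeff₂_eq_assocCE A YW u v w
  obtain ⟨z, hz⟩ := exists_coeff₂_eq_kerSubst hL
  obtain ⟨t₀, ht₀⟩ := exists_Fab_eq_zero (YW u) (YW v) w
  obtain ⟨k, hk⟩ := exists_pow_mulPoly_kerSubst_eq ht₀ hL hz
  have hfA : mulPoly (substAdd f) (kerSubst kerProd (Fab (YW u) (YW v) w)) =
      mulPoly (substAdd f) (coeff₂ c) := by
    rw [← prodCE_eq_kerSubst, hc, ← mulSubPoly_eq_mulPoly, ← mulSubPoly_eq_mulPoly]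
    exact funext fun a => funext (h a)
  have hXf : (X 0 ^ k * f : MvPolynomial (Fin 2) ℂ) ≠ 0 :=
    mul_ne_zero (pow_ne_zero _ (X_ne_zero _)) hf
  have hcz : qK p 1 • c = z := by
    refine smul_left_injective_qK hXf (coeff₂_injective ?_)
    rw [← hk, ← mul_smul₂, ← qK_mul, coeff₂_qK_smul, mul_right_comm, map_mul, mulPoly_mul,
      mulPoly_mul, hfA]
  rw [fullYE_eq_coeff₂ hz, ← hcz, ← mul_smul₂, qInv_mul_qK hp, one_smul₂, hc]

theorem exists_mulSubPoly_prodCE_eq {V : Type*} [AddCommGroup V] [Module ℂ V] {A : NLVA V}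
    {YW : V →ₗ[ℂ] EW W} {u v : V} {w : W} {p : MvPolynomial (Fin 2) ℂ} (hp : p ≠ 0)
    (hL : IsLaurent2 (mulPoly p (Fab (YW u) (YW v) w)))
    (h : assocCE (Yf A) (YWf YW) u v w = fullYE 1 p (YW u) (YW v) w) :
    ∃ f : MvPolynomial (Fin 2) ℂ, f ≠ 0 ∧ ∀ a b : ℤ,
      mulSubPoly f (prodCE (YWf YW) (YWf YW) u v w) a b =
      mulSubPoly f (assocCE (Yf A) (YWf YW) u v w) a b := by
  obtain ⟨z, hz⟩ := exists_coeff₂_eq_kerSubst hL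
  obtain ⟨t₀, ht₀⟩ := exists_Fab_eq_zero (YW u) (YW v) w
  obtain ⟨k, hk⟩ := exists_pow_mulPoly_kerSubst_eq ht₀ hL hz
  refine ⟨X 0 ^ k * 1 * p, mul_ne_zero (mul_ne_zero (pow_ne_zero _ (X_ne_zero _)) one_ne_zero) hp,
    fun a b => ?_⟩
  rw [mulSubPoly_eq_mulPoly, mulSubPoly_eq_mulPoly, prodCE_eq_kerSubst, hk, h,
    fullYE_eq_coeff₂ hz, ← coeff₂_qK_smul, qK_mul _ p, mul_smul₂, ← mul_smul₂ (qK p 1),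
    qK_mul_qInv hp, one_smul₂]

end VertexOperation

/-- cf. Proposition 2.14 / `pextra-need`.  Let `V` be a nonlocal
vertex algebra and `W` a vector space with a linear map `Y_W : V → ℰ(W)` such that
`Y_W(1,x) = 1_W`.  (1) If `(W, Y_W)` is a quasi `V`-module then for all `u, v ∈ V`
with `(Y_W(u,x), Y_W(v,x))` quasi compatible,
`Y_W(Y(u,x₀)v, x) = Y_ℰ(Y_W(u,x), x₀) Y_W(v,x)`.  (2) Conversely, if for all
`u, v ∈ V` the pair `(Y_W(u,x), Y_W(v,x))` is quasi compatible and the displayed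
identity holds, then `(W, Y_W)` is a quasi `V`-module. -/
theorem statement8 {V W : Type*} [AddCommGroup V] [Module ℂ V]
    [AddCommGroup W] [Module ℂ W]
    (A : NLVA V) (YW : V →ₗ[ℂ] EW W)
    (hvac : ∀ (w : W) (n : ℤ), mf (YW A.one) w n = if n = -1 then w else 0) :
    (IsQuasiModule A YW →
      ∀ u v : V, QCPair (YW u) (YW v) →
        ∀ n : ℤ, YW (Yf A u v n) = YE (YW u) (YW v) n) ∧
    ((∀ u v : V, QCPair (YW u) (YW v) ∧
        ∀ n : ℤ, YW (Yf A u v n) = YE (YW u) (YW v) n) →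
      IsQuasiModule A YW) := by
  refine ⟨fun hq u v hqc n => mf_injective ?_, fun h => ⟨hvac, fun u v w => ?_⟩⟩
  · funext w m
    obtain ⟨f, hf, hfw⟩ := hq.2 u v w
    have key := assocCE_eq_fullYE hf hfw hqc.choose_spec.1 (hqc.choose_spec.2 w)
    rw [mf_YE hqc, ← key, assocCE, YWf]
    congr 3 <;> ring
  · obtain ⟨hqc, hYE⟩ := h u v
    refine exists_mulSubPoly_prodCE_eq hqc.choose_spec.1 (hqc.choose_spec.2 w) ?_
    funext a b
    rw [assocCE, YWf, hYE, mf_YE hqc]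
    congr 1 <;> ring

end NVA
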